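/- arXiv:2303.17521 — 5 statements merged into one kernel-verified Lean document; each statement's English description precedes it below -/
import Mathlib

section
/- In the i.i.d. setting, assume ∫_{Ω̂} (1/β̂(a)) dP̂(a) < 1. Then φ is a fixed point of the sample-averaged Perron–Frobenius operator: for Lebesgue-almost every x ∈ [0,1], ∫_{Ω̂} (L_{β̂(a)} φ)(x) dP̂(a) = φ(x), where (L_α f)(x) = (1/α) ∑_{y ∈ [0,1], T_α(y) = x} f(y). -/
open MeasureTheory

/-- Apply beta-transformations with slopes `bs = [β(ω₁), …, β(ω_n)]` in order:
`τ_{ω₁…ω_n} = T_{β(ω_n)} ∘ ⋯ ∘ T_{β(ω₁)}`, where `T_α y = Int.fract (α * y)`. -/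
noncomputable def tauList (bs : List ℝ) (x : ℝ) : ℝ :=
  bs.foldl (fun y b => Int.fract (b * y)) x

/-- The (unnormalized) stationary density
`φ(x) = 1 + ∑_{n=1}^∞ ∫_{Ω̂^n} (∏ᵢ β̂(ωᵢ))⁻¹ 𝟙_{[0, τ_{ω₁…ω_n}(1)]}(x) dP̂^n`. -/
noncomputable def phiFun {Ω : Type*} [MeasurableSpace Ω] (P : Measure Ω) (β : Ω → ℝ)
    (x : ℝ) : ℝ :=
  1 + ∑' n : ℕ, ∫ w : Fin (n + 1) → Ω,
      (∏ i, β (w i))⁻¹ *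
        Set.indicator (Set.Icc (0:ℝ) (tauList (List.ofFn fun i => β (w i)) 1)) (fun _ => (1:ℝ)) x
      ∂(Measure.pi fun _ => P)

/-- The linear functional `h ↦ ∫ (∏ᵢ β(ωᵢ))⁻¹ h(τ_{ω₁…ω_n}(1)) dP^n`. -/
noncomputable def orbitIntegral {Ω : Type*} [MeasurableSpace Ω] (P : Measure Ω) (β : Ω → ℝ)
    (n : ℕ) (h : ℝ → ℝ) : ℝ :=
  ∫ w : Fin n → Ω, (∏ i, β (w i))⁻¹ * h (tauList (List.ofFn fun i => β (w i)) 1)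
    ∂(Measure.pi fun _ => P)

lemma tauList_mem_Icc (bs : List ℝ) {x : ℝ} (hx : x ∈ Set.Icc (0:ℝ) 1) :
    tauList bs x ∈ Set.Icc (0:ℝ) 1 := by
  induction bs generalizing x with
  | nil => exact hx
  | cons b bs ih => exact ih ⟨Int.fract_nonneg _, (Int.fract_lt_one _).le⟩

lemma tauList_ofFn_succ {n : ℕ} (f : Fin (n + 1) → ℝ) (x : ℝ) :
    tauList (List.ofFn f) x =
      Int.fract (f (Fin.last n) * tauList (List.ofFn fun i => f i.castSucc) x) := by
  rw [tauList, List.ofFn_succ_last, List.foldl_append]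
  rfl

lemma norm_prod_inv_mul_le {Ω : Type*} {β : Ω → ℝ} (hβpos : ∀ a, 0 < β a) {h : ℝ → ℝ}
    (hb : ∀ t ∈ Set.Icc (0:ℝ) 1, |h t| ≤ 1) {n : ℕ} (w : Fin n → Ω) {t : ℝ}
    (ht : t ∈ Set.Icc (0:ℝ) 1) :
    ‖(∏ i, β (w i))⁻¹ * h t‖ ≤ (∏ i, β (w i))⁻¹ := by
  have hp : 0 < (∏ i, β (w i))⁻¹ := inv_pos.2 (Finset.prod_pos fun i _ => hβpos _)
  rw [norm_mul, Real.norm_of_nonneg hp.le]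
  exact mul_le_of_le_one_right hp.le (hb t ht)

section OrbitIntegral

variable {Ω : Type*} [MeasurableSpace Ω] {P : Measure Ω} [IsProbabilityMeasure P] {β : Ω → ℝ}

lemma measurable_tauList_ofFn (hβ : Measurable β) (n : ℕ) :
    Measurable fun w : Fin n → Ω => tauList (List.ofFn fun i => β (w i)) 1 := by
  induction n with
  | zero => exact measurable_const
  | succ n ih =>
    simp_rw [tauList_ofFn_succ]
    refine Measurable.fract ((hβ.comp (measurable_pi_apply _)).mul ?_)
    exact ih.comp (measurable_pi_lambda (fun (w : Fin (n + 1) → Ω) (i : Fin n) => w i.castSucc)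
      fun _ => measurable_pi_apply _)

lemma integrable_prod_inv (hint : Integrable (fun a => (β a)⁻¹) P) (n : ℕ) :
    Integrable (fun w : Fin n → Ω => (∏ i, β (w i))⁻¹) (Measure.pi fun _ => P) := by
  simp_rw [← Finset.prod_inv_distrib]
  exact Integrable.fintype_prod (f := fun _ a => (β a)⁻¹) fun _ => hint

lemma integral_prod_inv (n : ℕ) :
    ∫ w : Fin n → Ω, (∏ i, β (w i))⁻¹ ∂(Measure.pi fun _ => P) = (∫ a, (β a)⁻¹ ∂P) ^ n := by
  simp_rw [← Finset.prod_inv_distrib]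
  rw [integral_fintype_prod_eq_pow (fun a => (β a)⁻¹), Fintype.card_fin]

lemma integrable_orbit (hβ : Measurable β) (hβpos : ∀ a, 0 < β a)
    (hint : Integrable (fun a => (β a)⁻¹) P) {h : ℝ → ℝ} (hm : Measurable h)
    (hb : ∀ t ∈ Set.Icc (0:ℝ) 1, |h t| ≤ 1) (n : ℕ) :
    Integrable (fun w : Fin n → Ω =>
      (∏ i, β (w i))⁻¹ * h (tauList (List.ofFn fun i => β (w i)) 1))
      (Measure.pi fun _ => P) := by
  refine (integrable_prod_inv hint n).mono' ?_ (.of_forall fun w =>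
    norm_prod_inv_mul_le hβpos hb w (tauList_mem_Icc _ ⟨zero_le_one, le_rfl⟩))
  exact (integrable_prod_inv hint n).1.mul
    (hm.comp (measurable_tauList_ofFn hβ n)).aestronglyMeasurable

lemma integrable_orbit_fract (hβ : Measurable β) (hβpos : ∀ a, 0 < β a)
    (hint : Integrable (fun a => (β a)⁻¹) P) {h : ℝ → ℝ} (hm : Measurable h)
    (hb : ∀ t ∈ Set.Icc (0:ℝ) 1, |h t| ≤ 1) (n : ℕ) (c : ℝ) :
    Integrable (fun w : Fin n → Ω =>
      (∏ i, β (w i))⁻¹ * h (Int.fract (c * tauList (List.ofFn fun i => β (w i)) 1)))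
      (Measure.pi fun _ => P) :=
  integrable_orbit hβ hβpos hint (h := fun t => h (Int.fract (c * t)))
    (hm.comp (measurable_const.mul measurable_id).fract)
    (fun _ _ => hb _ ⟨Int.fract_nonneg _, (Int.fract_lt_one _).le⟩) n

lemma norm_orbitIntegral_le (hβpos : ∀ a, 0 < β a)
    (hint : Integrable (fun a => (β a)⁻¹) P) {h : ℝ → ℝ}
    (hb : ∀ t ∈ Set.Icc (0:ℝ) 1, |h t| ≤ 1) (n : ℕ) :
    ‖orbitIntegral P β n h‖ ≤ (∫ a, (β a)⁻¹ ∂P) ^ n := by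
  rw [← integral_prod_inv]
  exact norm_integral_le_of_norm_le (integrable_prod_inv hint n) (.of_forall fun w =>
    norm_prod_inv_mul_le hβpos hb w (tauList_mem_Icc _ ⟨zero_le_one, le_rfl⟩))

/-- Splitting off the last letter of the word. -/
lemma orbitIntegral_succ (hβ : Measurable β) (hβpos : ∀ a, 0 < β a)
    (hint : Integrable (fun a => (β a)⁻¹) P) {h : ℝ → ℝ} (hm : Measurable h)
    (hb : ∀ t ∈ Set.Icc (0:ℝ) 1, |h t| ≤ 1) (n : ℕ) :
    Integrable (fun a => (β a)⁻¹ * orbitIntegral P β n fun t => h (Int.fract (β a * t))) P ∧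
      ∫ a, (β a)⁻¹ * orbitIntegral P β n (fun t => h (Int.fract (β a * t))) ∂P =
        orbitIntegral P β (n + 1) h := by
  have e := (measurePreserving_piFinSuccAbove (fun _ : Fin (n + 1) => P) (Fin.last n)).symm
  have key : ∀ p : Ω × (Fin n → Ω),
      (fun w : Fin (n + 1) → Ω =>
        (∏ i, β (w i))⁻¹ * h (tauList (List.ofFn fun i => β (w i)) 1))
        ((MeasurableEquiv.piFinSuccAbove (fun _ => Ω) (Fin.last n)).symm p) =
      (β p.1)⁻¹ * ((∏ i, β (p.2 i))⁻¹ *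
        h (Int.fract (β p.1 * tauList (List.ofFn fun i => β (p.2 i)) 1))) := by
    rintro ⟨a, w⟩
    have h1 : ∀ i : Fin n, (MeasurableEquiv.piFinSuccAbove (fun _ => Ω) (Fin.last n)).symm
        (a, w) i.castSucc = w i := fun i => by
      simp [MeasurableEquiv.piFinSuccAbove_symm_apply, Fin.insertNthEquiv]
    have h2 : (MeasurableEquiv.piFinSuccAbove (fun _ => Ω) (Fin.last n)).symm
        (a, w) (Fin.last n) = a := by
      simp [MeasurableEquiv.piFinSuccAbove_symm_apply, Fin.insertNthEquiv]
    simp only [tauList_ofFn_succ, Fin.prod_univ_castSucc, h1, h2, mul_inv]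
    ring
  have hi := (e.integrable_comp_emb (MeasurableEquiv.measurableEmbedding _)).2
    (integrable_orbit hβ hβpos hint hm hb (n + 1))
  have hi' := hi.congr (.of_forall key)
  refine ⟨?_, ?_⟩
  · refine hi'.integral_prod_left.congr (.of_forall fun a => ?_)
    exact integral_const_mul (β a)⁻¹ _
  · rw [orbitIntegral, ← e.integral_comp', integral_congr_ae (.of_forall key)]
    refine Eq.trans ?_ (integral_prod _ hi').symm
    exact integral_congr_ae (.of_forall fun a => (integral_const_mul (β a)⁻¹ _).symm)

end OrbitIntegral

/-- The indices `k` of the branches of `T_α` on which `x` has a preimage `(k + x) / α`. -/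
noncomputable def branchIndices (α x : ℝ) : Finset ℕ :=
  (Finset.range (⌊α⌋₊ + 1)).filter fun k => (k : ℝ) + x ≤ α

lemma mem_branchIndices {α x : ℝ} (hx : 0 ≤ x) {k : ℕ} :
    k ∈ branchIndices α x ↔ (k : ℝ) + x ≤ α := by
  simp only [branchIndices, Finset.mem_filter, Finset.mem_range, and_iff_right_iff_imp]
  exact fun h => Nat.lt_succ_of_le (Nat.le_floor (by linarith))

lemma finsum_mem_fract_preimage {α x : ℝ} (hα : 0 < α) (hx : x ∈ Set.Ico (0:ℝ) 1) (f : ℝ → ℝ) :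
    ∑ᶠ y ∈ {y : ℝ | y ∈ Set.Icc (0:ℝ) 1 ∧ Int.fract (α * y) = x}, f y =
      ∑ k ∈ branchIndices α x, f ((k + x) / α) := by
  have hS : {y : ℝ | y ∈ Set.Icc (0:ℝ) 1 ∧ Int.fract (α * y) = x} =
      (fun k : ℕ => ((k : ℝ) + x) / α) '' (branchIndices α x : Set ℕ) := by
    ext y
    simp only [Set.mem_ofPred_eq, Set.mem_image, Finset.mem_coe, mem_branchIndices hx.1]
    constructor
    · rintro ⟨hy, hf⟩
      have h0 : 0 ≤ α * y := mul_nonneg hα.le hy.1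
      have h1 : ((⌊α * y⌋₊ : ℕ) : ℝ) + x = α * y := by
        rw [← hf, natCast_floor_eq_intCast_floor h0, Int.floor_add_fract]
      refine ⟨⌊α * y⌋₊, ?_, ?_⟩
      · rw [h1]; exact mul_le_of_le_one_right hα.le hy.2
      · rw [h1]; field_simp
    · rintro ⟨k, hk, rfl⟩
      refine ⟨⟨div_nonneg (add_nonneg k.cast_nonneg hx.1) hα.le, (div_le_one hα).2 hk⟩, ?_⟩
      rw [mul_div_cancel₀ _ hα.ne', Int.fract_natCast_add, Int.fract_eq_self.2 hx]
  rw [hS, finsum_mem_image, finsum_mem_coe_finset]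
  intro k _ l _ hkl
  have := (div_left_inj' hα.ne').1 hkl
  exact_mod_cast add_right_cancel this

/-- `L_α 𝟙_{[0,t]} = (⌊αt⌋ + 𝟙_{[0, T_α t]}) / α`, pointwise on `[0,1)` and before dividing
by `α`. -/
lemma sum_branchIndices_indicator {α x t : ℝ} (hα : 0 < α) (hx : x ∈ Set.Ico (0:ℝ) 1)
    (ht : t ∈ Set.Icc (0:ℝ) 1) :
    ∑ k ∈ branchIndices α x, Set.indicator (Set.Icc (0:ℝ) t) (fun _ => (1:ℝ)) ((k + x) / α) =
      α * t - Int.fract (α * t) +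
        Set.indicator (Set.Icc (0:ℝ) (Int.fract (α * t))) (fun _ => (1:ℝ)) x := by
  have h0 : 0 ≤ α * t := mul_nonneg hα.le ht.1
  have hle : α * t ≤ α := mul_le_of_le_one_right hα.le ht.2
  have hfl : ((⌊α * t⌋₊ : ℕ) : ℝ) + Int.fract (α * t) = α * t := by
    rw [natCast_floor_eq_intCast_floor h0, Int.floor_add_fract]
  have hmem : ∀ k : ℕ, ((k : ℝ) + x) / α ∈ Set.Icc (0:ℝ) t ↔ (k : ℝ) + x ≤ α * t := fun k => by
    rw [Set.mem_Icc, div_le_iff₀' hα, and_iff_right]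
    exact div_nonneg (add_nonneg k.cast_nonneg hx.1) hα.le
  have hf1 := Int.fract_lt_one (α * t)
  have hcard : ∀ m : ℕ, (∀ k : ℕ, (k : ℝ) + x ≤ α * t ↔ k < m) →
      ∑ k ∈ branchIndices α x, Set.indicator (Set.Icc (0:ℝ) t) (fun _ => (1:ℝ)) ((k + x) / α) =
        m := fun m hm => by
    classical
    simp only [Set.indicator_apply, hmem, Finset.sum_boole]
    congr 1
    rw [← Finset.card_range m]
    congr 1
    ext k
    simp only [Finset.mem_filter, mem_branchIndices hx.1, Finset.mem_range, hm,
      and_iff_right_iff_imp]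
    exact fun h => ((hm k).2 h).trans hle
  by_cases hxt : x ≤ Int.fract (α * t)
  · rw [hcard (⌊α * t⌋₊ + 1), Set.indicator_of_mem (Set.mem_Icc.2 ⟨hx.1, hxt⟩)]
    · push_cast; linarith
    · intro k
      rw [Nat.lt_succ_iff]
      refine ⟨fun h => Nat.le_floor (by linarith [hx.1]), fun h => ?_⟩
      have : (k : ℝ) ≤ ⌊α * t⌋₊ := by exact_mod_cast h
      linarith
  · rw [hcard ⌊α * t⌋₊, Set.indicator_of_notMem (fun h => hxt h.2)]
    · linarith
    · intro k
      push Not at hxt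
      constructor
      · intro h
        have : (k : ℝ) < ⌊α * t⌋₊ := by linarith
        exact_mod_cast this
      · intro h
        have : (k : ℝ) + 1 ≤ ⌊α * t⌋₊ := by exact_mod_cast h
        linarith [hx.2, Int.fract_nonneg (α * t)]

lemma measurable_indicator_Icc_zero (x : ℝ) :
    Measurable fun t : ℝ => Set.indicator (Set.Icc (0:ℝ) t) (fun _ => (1:ℝ)) x := by
  classical
  simp only [Set.indicator_apply, Set.mem_Icc]
  exact Measurable.ite ((MeasurableSet.const (0 ≤ x)).inter measurableSet_Ici)
    measurable_const measurable_const

lemma abs_indicator_one_le (s : Set ℝ) (x : ℝ) :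
    |Set.indicator s (fun _ => (1:ℝ)) x| ≤ 1 := by
  by_cases h : x ∈ s <;> simp [h]

lemma abs_indicator_sub_le (x : ℝ) {t : ℝ} (ht : t ∈ Set.Icc (0:ℝ) 1) :
    |Set.indicator (Set.Icc (0:ℝ) t) (fun _ => (1:ℝ)) x - t| ≤ 1 := by
  obtain ⟨h0, h1⟩ := ht
  by_cases h : x ∈ Set.Icc (0:ℝ) t <;> simp only [h, Set.indicator_of_mem,
    Set.indicator_of_notMem, not_false_eq_true] <;> rw [abs_le] <;> constructor <;> linarith

section FixedPoint

variable {Ω : Type*} [MeasurableSpace Ω] {P : Measure Ω} [IsProbabilityMeasure P] {β : Ω → ℝ}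

lemma orbitIntegral_zero (h : ℝ → ℝ) : orbitIntegral P β 0 h = h 1 := by
  simp [orbitIntegral, tauList]

lemma summable_orbitIntegral (hβpos : ∀ a, 0 < β a)
    (hint : Integrable (fun a => (β a)⁻¹) P) (hr1 : ∫ a, (β a)⁻¹ ∂P < 1) {h : ℝ → ℝ}
    (hb : ∀ t ∈ Set.Icc (0:ℝ) 1, |h t| ≤ 1) :
    Summable fun n => orbitIntegral P β n h :=
  .of_norm_bounded
    (summable_geometric_of_lt_one (integral_nonneg fun a => (inv_pos.2 (hβpos a)).le) hr1)
    fun n => norm_orbitIntegral_le hβpos hint hb n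

lemma hasSum_phiFun (hβpos : ∀ a, 0 < β a)
    (hint : Integrable (fun a => (β a)⁻¹) P) (hr1 : ∫ a, (β a)⁻¹ ∂P < 1) {x : ℝ}
    (hx : x ∈ Set.Icc (0:ℝ) 1) :
    HasSum (fun n => orbitIntegral P β n
      fun t => Set.indicator (Set.Icc (0:ℝ) t) (fun _ => (1:ℝ)) x) (phiFun P β x) := by
  have hs := summable_orbitIntegral hβpos hint hr1
    (h := fun t => Set.indicator (Set.Icc (0:ℝ) t) (fun _ => (1:ℝ)) x)
    fun t _ => abs_indicator_one_le _ _
  convert hs.hasSum using 1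
  rw [hs.tsum_eq_zero_add, orbitIntegral_zero, Set.indicator_of_mem hx]
  rfl

/-- The transfer operator applied to the `n`-th summand of `φ`. -/
lemma inv_mul_sum_orbitIntegral (hβ : Measurable β) (hβpos : ∀ a, 0 < β a)
    (hint : Integrable (fun a => (β a)⁻¹) P) {x : ℝ} (hx : x ∈ Set.Ico (0:ℝ) 1) (n : ℕ)
    {α : ℝ} (hα : 0 < α) :
    α⁻¹ * ∑ k ∈ branchIndices α x, orbitIntegral P β n
        (fun t => Set.indicator (Set.Icc (0:ℝ) t) (fun _ => (1:ℝ)) ((k + x) / α)) =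
      orbitIntegral P β n id + α⁻¹ * orbitIntegral P β n (fun t =>
        Set.indicator (Set.Icc (0:ℝ) (Int.fract (α * t))) (fun _ => (1:ℝ)) x
          - Int.fract (α * t)) := by
  have hid : ∀ t ∈ Set.Icc (0:ℝ) 1, |id t| ≤ 1 := fun t ht => by
    rw [id, abs_of_nonneg ht.1]; exact ht.2
  unfold orbitIntegral
  rw [← integral_finsetSum _ fun k _ => integrable_orbit hβ hβpos hint
      (measurable_indicator_Icc_zero _) (fun t _ => abs_indicator_one_le _ _) n,
    ← integral_const_mul, ← integral_const_mul,
    ← integral_add (integrable_orbit hβ hβpos hint measurable_id hid n)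
      ((integrable_orbit_fract hβ hβpos hint
        (h := fun t => Set.indicator (Set.Icc (0:ℝ) t) (fun _ => (1:ℝ)) x - t)
        ((measurable_indicator_Icc_zero x).sub measurable_id)
        (fun t ht => abs_indicator_sub_le x ht) n α).const_mul _)]
  refine integral_congr_ae (.of_forall fun w => ?_)
  simp only [← Finset.mul_sum, id]
  rw [sum_branchIndices_indicator hα hx (tauList_mem_Icc _ ⟨zero_le_one, le_rfl⟩)]
  field_simp
  ring

lemma integral_transfer_phiFun (hβ : Measurable β) (hβpos : ∀ a, 0 < β a)
    (hint : Integrable (fun a => (β a)⁻¹) P) (hr1 : ∫ a, (β a)⁻¹ ∂P < 1) {x : ℝ}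
    (hx : x ∈ Set.Ico (0:ℝ) 1) :
    ∫ a, (β a)⁻¹ *
      ∑ᶠ y ∈ {y : ℝ | y ∈ Set.Icc (0:ℝ) 1 ∧ Int.fract (β a * y) = x}, phiFun P β y ∂P
        = phiFun P β x := by
  set r := ∫ a, (β a)⁻¹ ∂P with hr
  have hr0 : 0 ≤ r := integral_nonneg fun a => (inv_pos.2 (hβpos a)).le
  have hgeom := summable_geometric_of_lt_one hr0 hr1
  set g : ℝ → ℝ := fun t => Set.indicator (Set.Icc (0:ℝ) t) (fun _ => (1:ℝ)) x - t with hg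
  have hgm : Measurable g := (measurable_indicator_Icc_zero x).sub measurable_id
  have hgb : ∀ t ∈ Set.Icc (0:ℝ) 1, |g t| ≤ 1 := fun t ht => abs_indicator_sub_le x ht
  have hid : ∀ t ∈ Set.Icc (0:ℝ) 1, |id t| ≤ 1 := fun t ht => by
    rw [id, abs_of_nonneg ht.1]; exact ht.2
  set F : ℕ → Ω → ℝ := fun n a => orbitIntegral P β n id +
    (β a)⁻¹ * orbitIntegral P β n (fun t => g (Int.fract (β a * t))) with hF
  have hFint : ∀ n, Integrable (F n) P := fun n =>
    (integrable_const _).add (orbitIntegral_succ hβ hβpos hint hgm hgb n).1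
  have hFsum : ∀ n, ∫ a, F n a ∂P =
      orbitIntegral P β n id + orbitIntegral P β (n + 1) g := fun n => by
    rw [hF, integral_add (integrable_const _) (orbitIntegral_succ hβ hβpos hint hgm hgb n).1,
      (orbitIntegral_succ hβ hβpos hint hgm hgb n).2]
    simp
  have hFnorm : ∀ n a, ‖F n a‖ ≤ r ^ n + (β a)⁻¹ * r ^ n := fun n a => by
    refine (norm_add_le _ _).trans (add_le_add (norm_orbitIntegral_le hβpos hint hid n) ?_)
    rw [norm_mul, Real.norm_of_nonneg (inv_pos.2 (hβpos a)).le]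
    exact mul_le_mul_of_nonneg_left (norm_orbitIntegral_le hβpos hint
      (fun t _ => hgb _ ⟨Int.fract_nonneg _, (Int.fract_lt_one _).le⟩) n)
      (inv_pos.2 (hβpos a)).le
  have hsummable : Summable fun n => ∫ a, ‖F n a‖ ∂P := by
    refine .of_nonneg_of_le (fun n => integral_nonneg fun a => norm_nonneg _) (fun n => ?_)
      (hgeom.add (hgeom.mul_left r))
    refine (integral_mono (g := fun a => r ^ n + (β a)⁻¹ * r ^ n) (hFint n).norm
      ((integrable_const _).add (hint.mul_const _)) (hFnorm n)).trans_eq ?_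
    rw [integral_add (integrable_const _) (hint.mul_const _), integral_mul_const, ← hr]
    simp
  have hpt : ∀ a, (β a)⁻¹ *
      ∑ᶠ y ∈ {y : ℝ | y ∈ Set.Icc (0:ℝ) 1 ∧ Int.fract (β a * y) = x}, phiFun P β y =
      ∑' n, F n a := fun a => by
    rw [finsum_mem_fract_preimage (hβpos a) hx]
    have hk : ∀ k ∈ branchIndices (β a) x, ((k : ℝ) + x) / β a ∈ Set.Icc (0:ℝ) 1 :=
      fun k hk => ⟨div_nonneg (add_nonneg k.cast_nonneg hx.1) (hβpos a).le,
        (div_le_one (hβpos a)).2 ((mem_branchIndices hx.1).1 hk)⟩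
    have hs := (hasSum_sum fun k hk' =>
      hasSum_phiFun hβpos hint hr1 (hk k hk')).mul_left (β a)⁻¹
    rw [← hs.tsum_eq]
    exact tsum_congr fun n => inv_mul_sum_orbitIntegral hβ hβpos hint hx n (hβpos a)
  simp_rw [hpt]
  have hφ := hasSum_phiFun hβpos hint hr1 (Set.Ico_subset_Icc_self hx)
  have hd := summable_orbitIntegral hβpos hint hr1 hid
  have hsplit : ∀ n, orbitIntegral P β n g =
      orbitIntegral P β n (fun t => Set.indicator (Set.Icc (0:ℝ) t) (fun _ => (1:ℝ)) x)
        - orbitIntegral P β n id := fun n => by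
    unfold orbitIntegral
    rw [← integral_sub (integrable_orbit hβ hβpos hint (measurable_indicator_Icc_zero x)
      (fun t _ => abs_indicator_one_le _ _) n)
      (integrable_orbit hβ hβpos hint measurable_id hid n)]
    simp only [hg, mul_sub, id]
  have hg0 : orbitIntegral P β 0 g = 0 := by
    rw [orbitIntegral_zero, hg]
    simp [Set.indicator_of_mem (Set.Ico_subset_Icc_self hx)]
  have hG : HasSum (fun n => orbitIntegral P β n g)
      (phiFun P β x - ∑' n, orbitIntegral P β n id) := by
    simp_rw [hsplit]
    exact hφ.sub hd.hasSum
  have hG' := (hasSum_nat_add_iff' 1).2 hG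
  rw [Finset.sum_range_one, hg0, sub_zero] at hG'
  have hfinal := hasSum_integral_of_summable_integral_norm hFint hsummable
  simp_rw [hFsum] at hfinal
  rw [hfinal.unique (hd.hasSum.add hG'), add_sub_cancel]

end FixedPoint

/-- In the i.i.d. setting with `∫ 1/β̂ dP̂ < 1`, the function `φ` is a fixed
point of the sample-averaged Perron–Frobenius operator: for Lebesgue-a.e. `x ∈ [0,1]`,
`∫_{Ω̂} (L_{β̂(a)} φ)(x) dP̂(a) = φ(x)`, where `(L_α f)(x) = (1/α) ∑_{y ∈ [0,1], T_α y = x} f y`. -/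
theorem stmt_4 {Ω : Type*} [MeasurableSpace Ω] (P : Measure Ω) [IsProbabilityMeasure P]
    (β : Ω → ℝ) (hβmeas : Measurable β) (hβpos : ∀ a, 0 < β a)
    (hint : Integrable (fun a => (β a)⁻¹) P)
    (hr1 : ∫ a, (β a)⁻¹ ∂P < 1) :
    ∀ᵐ x ∂(volume.restrict (Set.Icc (0:ℝ) 1)),
      (∫ a, (β a)⁻¹ *
          ∑ᶠ y ∈ {y : ℝ | y ∈ Set.Icc (0:ℝ) 1 ∧ Int.fract (β a * y) = x}, phiFun P β y ∂P)
        = phiFun P β x := by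
  have h1 : ∀ᵐ x : ℝ ∂(volume.restrict (Set.Icc (0:ℝ) 1)), x ≠ 1 :=
    ae_restrict_of_ae (Measure.ae_ne volume 1)
  filter_upwards [h1, ae_restrict_mem measurableSet_Icc] with x hx1 hx
  exact integral_transfer_phiFun hβmeas hβpos hint hr1 ⟨hx.1, hx.2.lt_of_ne hx1⟩
end

section
/- Let 0 < β₀ ≤ β₁ with β₁ > 1, and let p_c be as defined. Then the function F(p) = 1 + ∑_{n=1}^∞ ∑_{w ∈ {0,1}^n} p^{k(w)} (1−p)^{n−k(w)} · τ_w(1)/β_w is real-analytic on (p_c, 1), and for every p ∈ (p_c,1) its derivative equals F′(p) = ∑_{n=1}^∞ ∑_{w ∈ {0,1}^n, w ∉ {0^n, 1^n}} p^{k(w)−1}(1−p)^{n−k(w)−1}(k(w) − np) · τ_w(1)/β_w + ∑_{n=1}^∞ n p^{n−1} T_{β₁}^n(1)/β₁^n − ∑_{n=1}^∞ n (1−p)^{n−1} T_{β₀}^n(1)/β₀^n. -/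
/-- The beta-transformation `T_α(x) = αx - ⌊αx⌋`. -/
noncomputable def betaT (α : ℝ) : ℝ → ℝ := fun x => Int.fract (α * x)

/-- `τ_w` for a word `w ∈ {0,1}^n`: apply `T_{β_{w₁}}` first, …, `T_{β_{w_n}}` last, with
`β_{w_i} = β₁` if `w_i = 1` and `β₀` otherwise. -/
noncomputable def tauWord {n : ℕ} (β₀ β₁ : ℝ) (w : Fin n → Bool) (x : ℝ) : ℝ :=
  (List.ofFn fun i => if w i then β₁ else β₀).foldl (fun y b => Int.fract (b * y)) x

/-- `k(w) = ∑ᵢ wᵢ`, the number of ones in the word `w`. -/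
def kWord {n : ℕ} (w : Fin n → Bool) : ℕ := (Finset.univ.filter fun i => w i = true).card

/-- `β_w = β₁^{k(w)} β₀^{n - k(w)}`. -/
noncomputable def betaWord {n : ℕ} (β₀ β₁ : ℝ) (w : Fin n → Bool) : ℝ :=
  β₁ ^ kWord w * β₀ ^ (n - kWord w)

theorem tauWord_mem_Ico {n : ℕ} (β₀ β₁ : ℝ) (w : Fin (n + 1) → Bool) (x : ℝ) :
    tauWord β₀ β₁ w x ∈ Set.Ico (0 : ℝ) 1 := by
  unfold tauWord
  rw [List.ofFn_succ', List.concat_eq_append, List.foldl_append]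
  exact ⟨Int.fract_nonneg _, Int.fract_lt_one _⟩

theorem foldl_replicate_eq_iterate (b x : ℝ) (n : ℕ) :
    (List.replicate n b).foldl (fun y b => Int.fract (b * y)) x = (betaT b)^[n] x := by
  induction n generalizing x with
  | zero => rfl
  | succ n ih => rw [List.replicate_succ, List.foldl_cons, ih, Function.iterate_succ_apply]; rfl

theorem tauWord_true (β₀ β₁ : ℝ) (n : ℕ) (x : ℝ) :
    tauWord β₀ β₁ (fun _ : Fin n => true) x = (betaT β₁)^[n] x := by
  simp [tauWord, List.ofFn_const, foldl_replicate_eq_iterate]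

theorem tauWord_false (β₀ β₁ : ℝ) (n : ℕ) (x : ℝ) :
    tauWord β₀ β₁ (fun _ : Fin n => false) x = (betaT β₀)^[n] x := by
  simp [tauWord, List.ofFn_const, foldl_replicate_eq_iterate]

theorem kWord_true (n : ℕ) : kWord (fun _ : Fin n => true) = n := by simp [kWord]

theorem kWord_false (n : ℕ) : kWord (fun _ : Fin n => false) = 0 := by simp [kWord]

theorem kWord_pos {n : ℕ} {w : Fin n → Bool} (hw : w ≠ fun _ => false) : 0 < kWord w := by
  obtain ⟨i, hi⟩ := Function.ne_iff.1 hw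
  exact Finset.card_pos.2 ⟨i, by simpa using hi⟩

theorem kWord_lt {n : ℕ} {w : Fin n → Bool} (hw : w ≠ fun _ => true) : kWord w < n := by
  obtain ⟨i, hi⟩ := Function.ne_iff.1 hw
  calc kWord w < (Finset.univ : Finset (Fin n)).card :=
        Finset.card_lt_card (Finset.filter_ssubset.2 ⟨i, Finset.mem_univ i, hi⟩)
    _ = n := by simp

theorem sum_pow_kWord (a b : ℝ) (n : ℕ) :
    ∑ w : Fin n → Bool, a ^ kWord w * b ^ (n - kWord w) = (a + b) ^ n := by
  have h := Fintype.sum_pow (fun c : Bool => if c then a else b) n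
  rw [Fintype.sum_bool] at h
  simp only [if_true, Bool.false_eq_true, if_false] at h
  rw [h]
  refine Finset.sum_congr rfl fun w _ => ?_
  have hc := Finset.card_filter_add_card_filter_not (s := (Finset.univ : Finset (Fin n)))
    (fun i => w i = true)
  rw [Finset.card_univ, Fintype.card_fin] at hc
  rw [Finset.prod_ite, Finset.prod_const, Finset.prod_const]
  congr 2
  unfold kWord
  omega

theorem sum_word_split {n : ℕ} (f : (Fin (n + 1) → Bool) → ℝ) :
    ∑ w, f w = (∑ w ∈ (Finset.univ.filter fun w : Fin (n + 1) → Bool =>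
        w ≠ (fun _ => true) ∧ w ≠ (fun _ => false)), f w)
      + f (fun _ => true) + f (fun _ => false) := by
  rw [← Finset.sum_filter_add_sum_filter_not Finset.univ (fun w : Fin (n + 1) → Bool =>
        w ≠ (fun _ => true) ∧ w ≠ (fun _ => false)) f, add_assoc]
  congr 1
  have hne : (fun _ : Fin (n + 1) => true) ≠ fun _ => false := fun h => by
    simpa using congrFun h 0
  rw [← Finset.sum_pair hne]
  refine Finset.sum_congr ?_ fun _ _ => rfl
  ext w
  simp only [Finset.mem_filter, Finset.mem_univ, true_and, Finset.mem_insert,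
    Finset.mem_singleton]
  tauto

/-- The contribution of the words of length `n + 1` to `F`, over a field containing `ℝ`. -/
noncomputable def levelSum (𝕜 : Type*) [Field 𝕜] [Algebra ℝ 𝕜] (β₀ β₁ : ℝ) (n : ℕ) (z : 𝕜) : 𝕜 :=
  ∑ w : Fin (n + 1) → Bool, z ^ kWord w * (1 - z) ^ (n + 1 - kWord w) *
    algebraMap ℝ 𝕜 (tauWord β₀ β₁ w 1 / betaWord β₀ β₁ w)

theorem levelSum_real (β₀ β₁ : ℝ) (n : ℕ) (p : ℝ) :
    levelSum ℝ β₀ β₁ n p = ∑ w : Fin (n + 1) → Bool,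
      p ^ kWord w * (1 - p) ^ (n + 1 - kWord w) * tauWord β₀ β₁ w 1 / betaWord β₀ β₁ w := by
  simp [levelSum, mul_div_assoc]

theorem levelSum_ofReal (β₀ β₁ : ℝ) (n : ℕ) (p : ℝ) :
    levelSum ℂ β₀ β₁ n p = (levelSum ℝ β₀ β₁ n p : ℝ) := by
  simp [levelSum]

theorem differentiable_levelSum (β₀ β₁ : ℝ) (n : ℕ) : Differentiable ℂ (levelSum ℂ β₀ β₁ n) := by
  unfold levelSum
  fun_prop

theorem norm_levelSum_le {β₀ β₁ : ℝ} (h0 : 0 < β₀) (h1 : 0 < β₁) (n : ℕ) (z : ℂ) :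
    ‖levelSum ℂ β₀ β₁ n z‖ ≤ (‖z‖ / β₁ + ‖1 - z‖ / β₀) ^ (n + 1) := by
  rw [← sum_pow_kWord]
  refine norm_sum_le_of_le _ fun w _ => ?_
  have hb : 0 < betaWord β₀ β₁ w := by unfold betaWord; positivity
  obtain ⟨ht0, ht1⟩ := tauWord_mem_Ico β₀ β₁ w 1
  rw [norm_mul, norm_mul, norm_pow, norm_pow, norm_algebraMap', Real.norm_eq_abs,
    abs_of_nonneg (div_nonneg ht0 hb.le), div_pow, div_pow, div_mul_div_comm, mul_div_assoc']
  change _ ≤ _ / betaWord β₀ β₁ w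
  exact div_le_div_of_nonneg_right (mul_le_of_le_one_right (by positivity) ht1.le) hb.le

theorem hasDerivAt_pow_mul_one_sub_pow (k m : ℕ) (p : ℝ) :
    HasDerivAt (fun x : ℝ => x ^ (k + 1) * (1 - x) ^ (m + 1))
      (p ^ k * (1 - p) ^ m * ((k + 1 : ℕ) - (k + m + 2) * p)) p := by
  have h := (hasDerivAt_pow (k + 1) p).mul (((hasDerivAt_id p).const_sub 1).pow (m + 1))
  refine h.congr_deriv ?_
  simp only [Nat.add_sub_cancel, id, Pi.pow_apply]
  push_cast
  ring

theorem hasDerivAt_levelSum (β₀ β₁ : ℝ) (n : ℕ) (p : ℝ) :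
    HasDerivAt (levelSum ℝ β₀ β₁ n)
      ((∑ w ∈ (Finset.univ.filter fun w : Fin (n + 1) → Bool =>
              w ≠ (fun _ => true) ∧ w ≠ (fun _ => false)),
            p ^ (kWord w - 1) * (1 - p) ^ (n + 1 - kWord w - 1)
              * ((kWord w : ℝ) - (n + 1) * p) * tauWord β₀ β₁ w 1 / betaWord β₀ β₁ w)
        + ((n : ℝ) + 1) * p ^ n * (betaT β₁)^[n + 1] 1 / β₁ ^ (n + 1)
        - ((n : ℝ) + 1) * (1 - p) ^ n * (betaT β₀)^[n + 1] 1 / β₀ ^ (n + 1)) p := by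
  have hF : levelSum ℝ β₀ β₁ n = fun x =>
      (∑ w ∈ (Finset.univ.filter fun w : Fin (n + 1) → Bool =>
          w ≠ (fun _ => true) ∧ w ≠ (fun _ => false)),
        x ^ kWord w * (1 - x) ^ (n + 1 - kWord w) * (tauWord β₀ β₁ w 1 / betaWord β₀ β₁ w))
      + x ^ (n + 1) * ((betaT β₁)^[n + 1] 1 / β₁ ^ (n + 1))
      + (1 - x) ^ (n + 1) * ((betaT β₀)^[n + 1] 1 / β₀ ^ (n + 1)) := by
    funext x
    rw [levelSum, sum_word_split]
    simp [tauWord_true, tauWord_false, kWord_true, kWord_false, betaWord]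
  rw [hF, sub_eq_add_neg]
  refine (HasDerivAt.add (HasDerivAt.fun_sum fun w hw => ?_) ?_).add ?_
  · obtain ⟨ht, hf⟩ := (Finset.mem_filter.1 hw).2
    obtain ⟨k, hk⟩ : ∃ k, kWord w = k + 1 := ⟨kWord w - 1, by have := kWord_pos hf; omega⟩
    obtain ⟨m, hm⟩ : ∃ m, n + 1 - kWord w = m + 1 :=
      ⟨n + 1 - kWord w - 1, by have := kWord_lt ht; omega⟩
    have hn : (n : ℝ) = k + m + 1 := by
      have : n = k + m + 1 := by omega
      exact_mod_cast this
    rw [hm, hk]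
    refine ((hasDerivAt_pow_mul_one_sub_pow k m p).mul_const _).congr_deriv ?_
    simp only [Nat.add_sub_cancel, hn]
    ring
  · refine ((hasDerivAt_pow (n + 1) p).mul_const _).congr_deriv ?_
    simp only [Nat.add_sub_cancel]
    push_cast
    ring
  · refine ((((hasDerivAt_id p).const_sub 1).pow (n + 1)).mul_const _).congr_deriv ?_
    simp only [Nat.add_sub_cancel, id]
    push_cast
    ring

theorem summable_succ_mul_pow_mul_iterate_betaT {β r : ℝ} (hβ : 0 < β) (hr0 : 0 ≤ r)
    (hr : r / β < 1) :
    Summable fun n : ℕ => ((n : ℝ) + 1) * r ^ n * (betaT β)^[n + 1] 1 / β ^ (n + 1) := by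
  have hq0 : 0 ≤ r / β := by positivity
  have hq : ‖r / β‖ < 1 := by rwa [Real.norm_of_nonneg hq0]
  have hs : Summable fun n : ℕ => ((n : ℝ) + 1) * (r / β) ^ n / β := by
    have h1 : Summable fun n : ℕ => (n : ℝ) * (r / β) ^ n := by
      simpa using summable_pow_mul_geometric_of_norm_lt_one 1 hq
    have h2 := summable_geometric_of_norm_lt_one hq
    simpa only [add_mul, one_mul] using (h1.add h2).div_const β
  have hT : ∀ n : ℕ, (betaT β)^[n + 1] 1 ∈ Set.Ico (0 : ℝ) 1 := fun n => by
    rw [Function.iterate_succ_apply']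
    exact ⟨Int.fract_nonneg _, Int.fract_lt_one _⟩
  refine hs.of_nonneg_of_le (fun n => ?_) fun n => ?_
  · have := (hT n).1
    positivity
  · calc ((n : ℝ) + 1) * r ^ n * (betaT β)^[n + 1] 1 / β ^ (n + 1)
        ≤ ((n : ℝ) + 1) * r ^ n / β ^ (n + 1) :=
          div_le_div_of_nonneg_right (mul_le_of_le_one_right (by positivity) (hT n).2.le)
            (by positivity)
      _ = _ := by rw [div_pow, pow_succ]; field_simp

theorem div_add_div_lt_one {β₀ β₁ pc p : ℝ} (h0 : 0 < β₀) (h1 : 1 < β₁)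
    (hpc0 : 1 ≤ β₀ → pc = 0)
    (hpc1 : β₀ < 1 → pc ∈ Set.Ioo (0:ℝ) 1 ∧ pc / β₁ + (1 - pc) / β₀ = 1)
    (hp : p ∈ Set.Ioo pc 1) : 0 < p ∧ p / β₁ + (1 - p) / β₀ < 1 := by
  obtain ⟨hp0, hp1⟩ := hp
  rcases le_or_gt 1 β₀ with h | h
  · obtain rfl := hpc0 h
    have e1 : p / β₁ < p := div_lt_self hp0 h1
    have e2 : (1 - p) / β₀ ≤ 1 - p := div_le_self (by linarith) h
    exact ⟨hp0, by linarith⟩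
  · obtain ⟨⟨hc0, _⟩, hc⟩ := hpc1 h
    refine ⟨hc0.trans hp0, ?_⟩
    have hlt : 1 / β₁ < 1 / β₀ := one_div_lt_one_div_of_lt h0 (h.trans h1)
    have e : p / β₁ + (1 - p) / β₀
        = pc / β₁ + (1 - pc) / β₀ - (p - pc) * (1 / β₀ - 1 / β₁) := by ring
    have := mul_pos (sub_pos.2 hp0) (sub_pos.2 hlt)
    linarith

theorem analyticAt_and_hasSum_deriv_tsum_levelSum {β₀ β₁ : ℝ} (h0 : 0 < β₀) (h1 : 0 < β₁) {z : ℂ}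
    (hz : ‖z‖ / β₁ + ‖1 - z‖ / β₀ < 1) :
    AnalyticAt ℂ (fun z => ∑' n, levelSum ℂ β₀ β₁ n z) z ∧
      HasSum (fun n => deriv (levelSum ℂ β₀ β₁ n) z)
        (deriv (fun z => ∑' n, levelSum ℂ β₀ β₁ n z) z) := by
  obtain ⟨r, hzr, hr⟩ := exists_between hz
  have hr0 : 0 ≤ r := le_trans (by positivity) hzr.le
  set U : Set ℂ := {z | ‖z‖ / β₁ + ‖1 - z‖ / β₀ < r}
  have hU : IsOpen U := isOpen_lt (by fun_prop) continuous_const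
  have hu : Summable fun n : ℕ => r ^ (n + 1) :=
    (summable_nat_add_iff 1).2 (summable_geometric_of_lt_one hr0 hr)
  have hd : ∀ n, DifferentiableOn ℂ (levelSum ℂ β₀ β₁ n) U := fun n =>
    (differentiable_levelSum β₀ β₁ n).differentiableOn
  have hle : ∀ n, ∀ z ∈ U, ‖levelSum ℂ β₀ β₁ n z‖ ≤ r ^ (n + 1) := fun n z hz =>
    (norm_levelSum_le h0 h1 n z).trans (pow_le_pow_left₀ (by positivity) (le_of_lt hz) _)
  exact ⟨(Complex.differentiableOn_tsum_of_summable_norm hu hd hU hle).analyticAt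
      (hU.mem_nhds hzr), Complex.hasSum_deriv_of_summable_norm hu hd hU hle hzr⟩

/-- For `0 < β₀ ≤ β₁`, `β₁ > 1` and `p_c` as defined, the function
`F(p) = 1 + ∑_n ∑_{w ∈ {0,1}^n} p^{k(w)} (1-p)^{n-k(w)} τ_w(1)/β_w` is real-analytic on
`(p_c, 1)` and its derivative is given by the stated explicit formula. -/
theorem stmt_9 (β₀ β₁ : ℝ) (h0 : 0 < β₀) (h01 : β₀ ≤ β₁) (h1 : 1 < β₁)
    (pc : ℝ) (hpc0 : 1 ≤ β₀ → pc = 0)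
    (hpc1 : β₀ < 1 → pc ∈ Set.Ioo (0:ℝ) 1 ∧ pc / β₁ + (1 - pc) / β₀ = 1) :
    AnalyticOnNhd ℝ
      (fun p : ℝ => 1 + ∑' n : ℕ, ∑ w : Fin (n + 1) → Bool,
        p ^ kWord w * (1 - p) ^ (n + 1 - kWord w) * tauWord β₀ β₁ w 1 / betaWord β₀ β₁ w)
      (Set.Ioo pc 1) ∧
    ∀ p ∈ Set.Ioo pc 1,
      HasDerivAt
        (fun p : ℝ => 1 + ∑' n : ℕ, ∑ w : Fin (n + 1) → Bool,
          p ^ kWord w * (1 - p) ^ (n + 1 - kWord w) * tauWord β₀ β₁ w 1 / betaWord β₀ β₁ w)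
        ((∑' n : ℕ, ∑ w ∈ (Finset.univ.filter fun w : Fin (n + 1) → Bool =>
              w ≠ (fun _ => true) ∧ w ≠ (fun _ => false)),
            p ^ (kWord w - 1) * (1 - p) ^ (n + 1 - kWord w - 1)
              * ((kWord w : ℝ) - (n + 1) * p) * tauWord β₀ β₁ w 1 / betaWord β₀ β₁ w)
          + (∑' n : ℕ, ((n : ℝ) + 1) * p ^ n * (betaT β₁)^[n + 1] 1 / β₁ ^ (n + 1))
          - (∑' n : ℕ, ((n : ℝ) + 1) * (1 - p) ^ n * (betaT β₀)^[n + 1] 1 / β₀ ^ (n + 1)))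
        p := by
  have hβ₁ : 0 < β₁ := h0.trans_le h01
  have hre : (fun p : ℝ => 1 + ∑' n : ℕ, ∑ w : Fin (n + 1) → Bool,
      p ^ kWord w * (1 - p) ^ (n + 1 - kWord w) * tauWord β₀ β₁ w 1 / betaWord β₀ β₁ w)
      = fun p : ℝ => 1 + (∑' n, levelSum ℂ β₀ β₁ n (p : ℂ)).re := by
    funext p
    simp only [levelSum_ofReal, ← levelSum_real]
    rw [← Complex.ofReal_tsum, Complex.ofReal_re]
  rw [hre]
  have key : ∀ p ∈ Set.Ioo pc 1, 0 < p ∧ p / β₁ + (1 - p) / β₀ < 1 := fun p hp =>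
    div_add_div_lt_one h0 h1 hpc0 hpc1 hp
  have main : ∀ p ∈ Set.Ioo pc 1, _ := fun p hp =>
    analyticAt_and_hasSum_deriv_tsum_levelSum h0 hβ₁ (z := (p : ℂ)) (by
      have hq : ‖(1 : ℂ) - p‖ = 1 - p := by
        rw [← Complex.ofReal_one, ← Complex.ofReal_sub, Complex.norm_real,
          Real.norm_of_nonneg (by linarith [hp.2])]
      rw [hq, Complex.norm_real, Real.norm_of_nonneg (key p hp).1.le]
      exact (key p hp).2)
  refine ⟨fun p hp => analyticAt_const.add (main p hp).1.re_ofReal, fun p hp => ?_⟩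
  obtain ⟨hp0, hlt⟩ := key p hp
  obtain ⟨han, hsum⟩ := main p hp
  refine (han.differentiableAt.hasDerivAt.real_of_complex.const_add 1).congr_deriv ?_
  have hderiv : ∀ n, (deriv (levelSum ℂ β₀ β₁ n) p).re = _ := fun n =>
    HasDerivAt.unique
      ((differentiable_levelSum β₀ β₁ n p).hasDerivAt.real_of_complex.congr_of_eventuallyEq
        (.of_forall fun x => by simp only [levelSum_ofReal, Complex.ofReal_re]))
      (hasDerivAt_levelSum β₀ β₁ n p)
  have hS := Complex.hasSum_re hsum
  simp only [hderiv] at hS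
  have hq₁ : 0 < p / β₁ := by positivity
  have hq₀ : 0 < (1 - p) / β₀ := div_pos (by linarith [hp.2]) h0
  have hA := summable_succ_mul_pow_mul_iterate_betaT hβ₁ hp0.le (by linarith)
  have hB := summable_succ_mul_pow_mul_iterate_betaT h0 (r := 1 - p) (by linarith [hp.2])
    (by linarith)
  have hN := (hS.add hB.hasSum).sub hA.hasSum
  simp only [sub_add_cancel, add_sub_cancel_right] at hN
  rw [hN.tsum_eq]
  ring
end

section
/- Let β₀ > 1 be non-simple. Define ξ(z) = ∑_{n=0}^∞ T_{β₀}^n(1) z^n / β₀^n, a power series with radius of convergence at least β₀. Then: (i) for every z ∈ ℂ with |z| < β₀, (1 − z) ξ(z) = 1 − ∑_{n=1}^∞ ⌊β₀ T_{β₀}^{n−1}(1)⌋ z^n / β₀^n; (ii) ξ(z) ≠ 0 for every z ∈ ℂ with |z| ≤ 1; and (iii) there exists r > 1 such that 1/ξ is analytic on the open ball {z ∈ ℂ : |z| < r}, so the Maclaurin series of 1/ξ has radius of convergence greater than 1. -/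
/-- The power series `ξ(z) = ∑_{n=0}^∞ T_{β₀}^n(1) zⁿ / β₀ⁿ`. -/
noncomputable def xiFun (β₀ : ℝ) (z : ℂ) : ℂ :=
  ∑' n : ℕ, (((betaT β₀)^[n] 1 : ℝ) : ℂ) * z ^ n / (β₀ : ℂ) ^ n

lemma betaT_iterate_mem_Icc (β : ℝ) (n : ℕ) : (betaT β)^[n] 1 ∈ Set.Icc (0 : ℝ) 1 := by
  cases n with
  | zero => simp
  | succ n =>
    rw [Function.iterate_succ_apply']
    exact ⟨Int.fract_nonneg _, (Int.fract_lt_one _).le⟩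

lemma norm_xiFun_term_le {β : ℝ} (hβ : 0 < β) (n : ℕ) {z : ℂ} {ρ : ℝ} (hz : ‖z‖ ≤ ρ) :
    ‖(((betaT β)^[n] 1 : ℝ) : ℂ) * z ^ n / (β : ℂ) ^ n‖ ≤ (ρ / β) ^ n := by
  obtain ⟨h0, h1⟩ := betaT_iterate_mem_Icc β n
  rw [norm_div, norm_mul, norm_pow, norm_pow, Complex.norm_real, Complex.norm_real,
    Real.norm_of_nonneg h0, Real.norm_of_nonneg hβ.le, div_pow]
  gcongr
  calc (betaT β)^[n] 1 * ‖z‖ ^ n ≤ 1 * ‖z‖ ^ n := by gcongr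
    _ ≤ ρ ^ n := by rw [one_mul]; gcongr

lemma summable_xiFun_term {β : ℝ} (hβ : 0 < β) {z : ℂ} (hz : ‖z‖ < β) :
    Summable fun n : ℕ => (((betaT β)^[n] 1 : ℝ) : ℂ) * z ^ n / (β : ℂ) ^ n :=
  .of_norm_bounded
    (summable_geometric_of_lt_one (by positivity) ((div_lt_one hβ).2 hz))
    fun n => norm_xiFun_term_le hβ n le_rfl

/-- The beta-expansion digits of `1` are the coefficients of `1 - (1 - z) ξ(z)`. -/
lemma hasSum_digits {β : ℝ} (hβ : 0 < β) {z : ℂ} (hz : ‖z‖ < β) :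
    HasSum (fun n : ℕ =>
      ((⌊β * (betaT β)^[n] 1⌋ : ℝ) : ℂ) * z ^ (n + 1) / (β : ℂ) ^ (n + 1))
      (1 - (1 - z) * xiFun β z) := by
  have h : HasSum _ (xiFun β z) := (summable_xiFun_term hβ hz).hasSum
  have hshift := (hasSum_nat_add_iff' 1).2 h
  convert (h.mul_left z).sub hshift using 1
  · rfl
  · funext n
    have hβ' : (β : ℂ) ≠ 0 := by exact_mod_cast hβ.ne'
    have hdigit : (((betaT β)^[n + 1] 1 : ℝ) : ℂ)
        = β * (((betaT β)^[n] 1 : ℝ) : ℂ) - ((⌊β * (betaT β)^[n] 1⌋ : ℝ) : ℂ) := by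
      rw [Function.iterate_succ_apply']
      simp only [betaT, Int.fract]
      push_cast
      rfl
    rw [hdigit]
    field_simp
    ring
  · simp
    ring

lemma differentiableOn_xiFun {β : ℝ} (hβ : 0 < β) :
    DifferentiableOn ℂ (xiFun β) (Metric.ball 0 β) := by
  intro z hz
  obtain ⟨ρ, hzρ, hρβ⟩ := exists_between (mem_ball_zero_iff.1 hz)
  have hρ : 0 ≤ ρ := (norm_nonneg z).trans hzρ.le
  have hd : DifferentiableOn ℂ (xiFun β) (Metric.ball 0 ρ) :=
    Complex.differentiableOn_tsum_of_summable_norm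
      (summable_geometric_of_lt_one (by positivity) ((div_lt_one hβ).2 hρβ))
      (fun n => by fun_prop) Metric.isOpen_ball
      fun n w hw => norm_xiFun_term_le hβ n (mem_ball_zero_iff.1 hw).le
  exact (hd.differentiableAt
    (Metric.isOpen_ball.mem_nhds (mem_ball_zero_iff.2 hzρ))).differentiableWithinAt

lemma xiFun_one_ne_zero {β : ℝ} (hβ : 1 < β) : xiFun β 1 ≠ 0 := by
  intro h0
  have h : HasSum _ (xiFun β 1) :=
    (summable_xiFun_term (z := 1) (zero_lt_one.trans hβ) (by simpa using hβ)).hasSum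
  have hr : HasSum (fun n : ℕ => (betaT β)^[n] 1 / β ^ n) 0 := by
    rw [h0] at h
    rw [← Complex.hasSum_ofReal]
    simpa using h
  have hnonneg (n : ℕ) : 0 ≤ (betaT β)^[n] 1 / β ^ n :=
    div_nonneg (betaT_iterate_mem_Icc β n).1 (by positivity)
  simpa using congrFun ((hasSum_zero_iff_of_nonneg hnonneg).1 hr) 0

lemma xiFun_ne_zero {β : ℝ} (hβ : 1 < β) {z : ℂ} (hz : ‖z‖ ≤ 1) : xiFun β z ≠ 0 := by
  intro h0
  have hβ0 : 0 < β := zero_lt_one.trans hβ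
  have hsum := (hasSum_digits (z := 1) hβ0 (by simpa using hβ)).sub
    (hasSum_digits hβ0 (hz.trans_lt hβ))
  have hre : HasSum (fun n : ℕ =>
      (⌊β * (betaT β)^[n] 1⌋ : ℝ) / β ^ (n + 1) * (1 - (z ^ (n + 1)).re)) 0 := by
    convert Complex.hasSum_re hsum using 1
    · funext n
      have hterm : ((⌊β * (betaT β)^[n] 1⌋ : ℝ) : ℂ) * 1 ^ (n + 1) / (β : ℂ) ^ (n + 1)
          - ((⌊β * (betaT β)^[n] 1⌋ : ℝ) : ℂ) * z ^ (n + 1) / (β : ℂ) ^ (n + 1)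
          = (((⌊β * (betaT β)^[n] 1⌋ : ℝ) / β ^ (n + 1) : ℝ) : ℂ) * (1 - z ^ (n + 1)) := by
        push_cast
        ring
      rw [hterm, Complex.re_ofReal_mul]
      simp
    · simp [h0]
  have hnonneg (n : ℕ) :
      0 ≤ (⌊β * (betaT β)^[n] 1⌋ : ℝ) / β ^ (n + 1) * (1 - (z ^ (n + 1)).re) := by
    have hfloor : (0 : ℝ) ≤ ⌊β * (betaT β)^[n] 1⌋ := by
      exact_mod_cast Int.floor_nonneg.2 (mul_nonneg hβ0.le (betaT_iterate_mem_Icc β n).1)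
    have hpow : (z ^ (n + 1)).re ≤ 1 :=
      (Complex.re_le_norm _).trans (by rw [norm_pow]; exact pow_le_one₀ (norm_nonneg z) hz)
    exact mul_nonneg (by positivity) (sub_nonneg.2 hpow)
  have hfirst := congrFun ((hasSum_zero_iff_of_nonneg hnonneg).1 hre) 0
  have hfloor : (⌊β⌋ : ℝ) ≠ 0 := by
    exact_mod_cast (Int.floor_pos.2 hβ.le).ne'
  have hz_re : z.re = 1 := by
    have : 1 - z.re = 0 := by simpa [hfloor, hβ0.ne'] using hfirst
    linarith
  have hz_im : z.im = 0 := by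
    have hsq : ‖z‖ ^ 2 ≤ 1 := pow_le_one₀ (norm_nonneg z) hz
    rw [Complex.sq_norm, Complex.normSq_apply, hz_re] at hsq
    nlinarith [mul_self_nonneg z.im]
  have hz_one : z = 1 := Complex.ext (by simpa using hz_re) (by simpa using hz_im)
  exact xiFun_one_ne_zero hβ (hz_one ▸ h0)

lemma exists_analyticOnNhd_inv_xiFun {β : ℝ} (hβ : 1 < β) :
    ∃ r : ℝ, 1 < r ∧ AnalyticOnNhd ℂ (fun z => (xiFun β z)⁻¹) (Metric.ball 0 r) := by
  have hd := differentiableOn_xiFun (zero_lt_one.trans hβ)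
  have hopen : IsOpen (Metric.ball 0 β ∩ xiFun β ⁻¹' {0}ᶜ) :=
    hd.continuousOn.isOpen_inter_preimage Metric.isOpen_ball isOpen_compl_singleton
  have hsub : Metric.closedBall 0 1 ⊆ Metric.ball 0 β ∩ xiFun β ⁻¹' {0}ᶜ :=
    fun z hz => ⟨Metric.closedBall_subset_ball hβ hz,
      xiFun_ne_zero hβ (mem_closedBall_zero_iff.1 hz)⟩
  obtain ⟨δ, hδ, hthick⟩ :=
    (isCompact_closedBall (0 : ℂ) 1).exists_thickening_subset_open hopen hsub
  rw [thickening_closedBall hδ zero_le_one] at hthick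
  refine ⟨δ + 1, by linarith, DifferentiableOn.analyticOnNhd ?_ Metric.isOpen_ball⟩
  exact (hd.mono fun z hz => (hthick hz).1).inv fun z hz => (hthick hz).2


/-- Let `β₀ > 1` be non-simple (`T_{β₀}^N(1) ≠ 0` for all `N ≥ 1`). Then:
the series for `ξ` converges for `|z| < β₀` (radius of convergence at least `β₀`);
(i) `(1 - z) ξ(z) = 1 - ∑_{n=1}^∞ ⌊β₀ T_{β₀}^{n-1}(1)⌋ zⁿ / β₀ⁿ` for `|z| < β₀`;
(ii) `ξ(z) ≠ 0` for `|z| ≤ 1`; and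
(iii) there is `r > 1` such that `1/ξ` is analytic on `{|z| < r}`. -/
theorem stmt_17 (β₀ : ℝ) (hβ₀ : 1 < β₀)
    (hns : ∀ N : ℕ, 1 ≤ N → (betaT β₀)^[N] 1 ≠ 0) :
    (∀ z : ℂ, ‖z‖ < β₀ →
      Summable fun n : ℕ => (((betaT β₀)^[n] 1 : ℝ) : ℂ) * z ^ n / (β₀ : ℂ) ^ n) ∧
    (∀ z : ℂ, ‖z‖ < β₀ →
      (1 - z) * xiFun β₀ z
        = 1 - ∑' n : ℕ,
            ((⌊β₀ * (betaT β₀)^[n] 1⌋ : ℝ) : ℂ) * z ^ (n + 1) / (β₀ : ℂ) ^ (n + 1)) ∧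
    (∀ z : ℂ, ‖z‖ ≤ 1 → xiFun β₀ z ≠ 0) ∧
    (∃ r : ℝ, 1 < r ∧ AnalyticOnNhd ℂ (fun z => (xiFun β₀ z)⁻¹) (Metric.ball 0 r)) := by
  have hpos : 0 < β₀ := zero_lt_one.trans hβ₀
  refine ⟨fun z hz => summable_xiFun_term hpos hz, fun z hz => ?_,
    fun z hz => xiFun_ne_zero hβ₀ hz, exists_analyticOnNhd_inv_xiFun hβ₀⟩
  rw [(hasSum_digits hpos hz).tsum_eq, sub_sub_cancel]
end

section
/- Let β₀ > 1 be non-simple and θ an invertible bi-measurable measure-preserving map of a probability space (Ω, F, P). Let t_n be the Maclaurin coefficients of 1/ξ, where ξ(z) = ∑_{n=0}^∞ T_{β₀}^n(1) z^n / β₀^n. Then ∑_{n=0}^∞ |t_n| < ∞, and for every f ∈ L¹(P) the series g = ∑_{n=0}^∞ t_n · (f ∘ θ^{−n}) converges in L¹(P) and satisfies, for P-a.e. ω, g(ω) + ∑_{n=1}^∞ (T_{β₀}^n(1)/β₀^n) g(θ^{−n}ω) = f(ω); i.e., the operator I + V on L¹(P), where (Vf)(ω) = ∑_{n=1}^∞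 (T_{β₀}^n(1)/β₀^n) f(θ^{−n}ω), is invertible with inverse ∑_{n=0}^∞ t_n U_{θ^{-1}}^n, U_{θ^{-1}}f = f ∘ θ^{-1}. -/
open MeasureTheory Filter

/-- The operator `V`: `(Vf)(ω) = ∑_{n=1}^∞ (T_{β₀}^n(1)/β₀ⁿ) f(θ^{-n}ω)`. -/
noncomputable def VOp {Ω : Type*} (β₀ : ℝ) (θinv : Ω → Ω) (f : Ω → ℝ) (ω : Ω) : ℝ :=
  ∑' n : ℕ, (betaT β₀)^[n + 1] 1 / β₀ ^ (n + 1) * f (θinv^[n + 1] ω)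

section SummableLOne

variable {Ω : Type*} [MeasurableSpace Ω] {μ : Measure Ω}

/-- The pointwise sum of the norms of a series with summable `L¹` norms is integrable. -/
theorem integrable_tsum_norm_of_tsum_eLpNorm_ne_top {F : ℕ → Ω → ℝ}
    (hF : ∀ n, AEStronglyMeasurable (F n) μ) (h : ∑' n, eLpNorm (F n) 1 μ ≠ ⊤) :
    Integrable (fun ω => ∑' n, ‖F n ω‖) μ := by
  have hsum := summable_norm_of_tsum_eLpNorm_ne_top le_rfl hF h
  constructor
  · refine aestronglyMeasurable_of_tendsto_ae atTop
      (f := fun N ω => ∑ n ∈ Finset.range N, ‖F n ω‖)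
      (fun N => Finset.aestronglyMeasurable_fun_sum _ fun n _ => (hF n).norm) ?_
    filter_upwards [hsum] with ω hω using hω.hasSum.tendsto_sum_nat
  · have hlt : ∫⁻ ω, ∑' n, ‖F n ω‖ₑ ∂μ < ⊤ := by
      rw [lintegral_tsum fun n => (hF n).enorm]
      simpa only [eLpNorm_one_eq_lintegral_enorm] using h.lt_top
    refine lt_of_le_of_lt (lintegral_mono fun ω => ?_) hlt
    exact enorm_tsum_le_tsum_enorm.trans_eq (by simp)

/-- A series with summable `L¹` norms has an integrable sum and converges to it in `L¹`. -/
theorem integrable_tsum_and_tendsto_of_tsum_eLpNorm_ne_top {F : ℕ → Ω → ℝ}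
    (hF : ∀ n, AEStronglyMeasurable (F n) μ) (h : ∑' n, eLpNorm (F n) 1 μ ≠ ⊤) :
    Integrable (fun ω => ∑' n, F n ω) μ ∧
      Tendsto (fun N => ∫ ω, |(∑ n ∈ Finset.range N, F n ω) - ∑' n, F n ω| ∂μ) atTop (nhds 0) := by
  have hsum := summable_norm_of_tsum_eLpNorm_ne_top le_rfl hF h
  have hbound := integrable_tsum_norm_of_tsum_eLpNorm_ne_top hF h
  have hpart (N : ℕ) : AEStronglyMeasurable (fun ω => ∑ n ∈ Finset.range N, F n ω) μ :=
    Finset.aestronglyMeasurable_fun_sum _ fun n _ => hF n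
  have htendsto : ∀ᵐ ω ∂μ,
      Tendsto (fun N => ∑ n ∈ Finset.range N, F n ω) atTop (nhds (∑' n, F n ω)) := by
    filter_upwards [hsum] with ω hω using hω.of_norm.hasSum.tendsto_sum_nat
  have hmeas : AEStronglyMeasurable (fun ω => ∑' n, F n ω) μ :=
    aestronglyMeasurable_of_tendsto_ae atTop hpart htendsto
  refine ⟨hbound.mono' hmeas ?_, ?_⟩
  · filter_upwards [hsum] with ω hω using norm_tsum_le_tsum_norm hω
  · have := tendsto_integral_of_dominated_convergence
      (F := fun N ω => |(∑ n ∈ Finset.range N, F n ω) - ∑' n, F n ω|) (f := fun _ => (0 : ℝ))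
      (fun ω => (∑' n, ‖F n ω‖) + ∑' n, ‖F n ω‖) (fun N => ((hpart N).sub hmeas).norm)
      (hbound.add hbound) (fun N => ?_) ?_
    · simpa using this
    · filter_upwards [hsum] with ω hω
      rw [Real.norm_eq_abs, abs_abs]
      refine (norm_sub_le _ _).trans (add_le_add ?_ (norm_tsum_le_tsum_norm hω))
      exact (norm_sum_le _ _).trans (hω.sum_le_tsum _ fun _ _ => norm_nonneg _)
    · filter_upwards [htendsto] with ω hω
      simpa using (hω.sub_const (∑' n, F n ω)).abs

/-- Composing an integrable function with iterates of a measure-preserving map and weighting by an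
absolutely summable family gives summable `L¹` norms. -/
theorem tsum_eLpNorm_mul_comp_iterate_ne_top {ι : Type*} {S : Ω → Ω}
    (hS : MeasurePreserving S μ μ) {f : Ω → ℝ} (hf : Integrable f μ) {c : ι → ℝ}
    (hc : Summable fun i => ‖c i‖) (e : ι → ℕ) :
    ∑' i, eLpNorm (fun ω => c i * f (S^[e i] ω)) 1 μ ≠ ⊤ := by
  have hnorm (i : ι) : eLpNorm (fun ω => c i * f (S^[e i] ω)) 1 μ = ‖c i‖ₑ * eLpNorm f 1 μ := by
    rw [← eLpNorm_comp_measurePreserving hf.aestronglyMeasurable (hS.iterate (e i))]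
    exact eLpNorm_const_smul (c i) _ _ _
  simp_rw [hnorm, ENNReal.tsum_mul_right]
  exact ENNReal.mul_ne_top (tsum_enorm_ne_top_iff_summable_norm.2 hc)
    (memLp_one_iff_integrable.2 hf).eLpNorm_ne_top

theorem aestronglyMeasurable_mul_comp_iterate {S : Ω → Ω}
    (hS : MeasurePreserving S μ μ) {f : Ω → ℝ} (hf : Integrable f μ) (c : ℝ) (n : ℕ) :
    AEStronglyMeasurable (fun ω => c * f (S^[n] ω)) μ :=
  (hf.aestronglyMeasurable.comp_measurePreserving (hS.iterate n)).const_mul c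

end SummableLOne

/-- If `a` and `b` are inverse to each other for the Cauchy product, then so are the associated
weighted shifts, at every sequence for which the double series converges absolutely. -/
theorem tsum_mul_tsum_shift_eq_of_antidiagonal {a b x : ℕ → ℝ}
    (hab : ∀ n, ∑ p ∈ Finset.HasAntidiagonal.antidiagonal n, a p.1 * b p.2 = if n = 0 then 1 else 0)
    (hs : Summable fun p : ℕ × ℕ => a p.1 * b p.2 * x (p.1 + p.2)) :
    ∑' m, a m * ∑' k, b k * x (m + k) = x 0 := by
  calc ∑' m, a m * ∑' k, b k * x (m + k)
      = ∑' p : ℕ × ℕ, a p.1 * b p.2 * x (p.1 + p.2) := by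
        rw [hs.tsum_prod]
        simp_rw [mul_assoc, tsum_mul_left]
    _ = ∑' n, ∑ p ∈ Finset.HasAntidiagonal.antidiagonal n, a p.1 * b p.2 * x (p.1 + p.2) := by
        rw [← Finset.HasAntidiagonal.sigmaAntidiagonalEquivProd.tsum_eq]
        refine (((Finset.HasAntidiagonal.sigmaAntidiagonalEquivProd.summable_iff).2 hs).tsum_sigma'
          fun n => (hasSum_fintype _).summable).trans (tsum_congr fun n => ?_)
        rw [tsum_fintype]
        exact Finset.sum_finset_coe (fun p : ℕ × ℕ => a p.1 * b p.2 * x (p.1 + p.2)) _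
    _ = ∑' n, (if n = 0 then 1 else 0) * x n := by
        refine tsum_congr fun n => ?_
        rw [← hab n, Finset.sum_mul]
        refine Finset.sum_congr rfl fun p hp => ?_
        rw [Finset.HasAntidiagonal.mem_antidiagonal.1 hp]
    _ = x 0 := by
        rw [tsum_eq_single 0 fun n hn => by simp [hn]]
        simp

/-- The coefficients of two power series that are pointwise inverse near `0` are inverse to each
other for the Cauchy product. -/
theorem sum_antidiagonal_eq_of_hasSum_inv {a b : ℕ → ℂ} {φ : ℂ → ℂ} (ha₀ : a 0 = 1)
    (ha : ∀ z : ℂ, ‖z‖ < 1 → HasSum (fun n => a n * z ^ n) (φ z))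
    (hb : ∀ z : ℂ, ‖z‖ < 1 → HasSum (fun n => b n * z ^ n) (φ z)⁻¹) (n : ℕ) :
    ∑ p ∈ Finset.HasAntidiagonal.antidiagonal n, a p.1 * b p.2 = if n = 0 then 1 else 0 := by
  have hball : ∀ᶠ z : ℂ in nhds 0, ‖z‖ < 1 :=
    continuous_norm.continuousAt.eventually_lt_const (by simp)
  have hφ : HasFPowerSeriesAt φ (FormalMultilinearSeries.ofScalars ℂ a) 0 := by
    rw [hasFPowerSeriesAt_iff]
    filter_upwards [hball] with z hz
    simpa [FormalMultilinearSeries.coeff_ofScalars, mul_comm] using ha z hz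
  have hφ₀ : φ 0 = 1 := by
    have h := (ha 0 (by simp)).tsum_eq
    rw [tsum_eq_single 0 fun n hn => by simp [hn]] at h
    simpa [ha₀] using h.symm
  have hne : ∀ᶠ z in nhds 0, φ z ≠ 0 :=
    hφ.continuousAt.eventually_ne (by simp [hφ₀])
  set c : ℕ → ℂ := fun n => ∑ p ∈ Finset.HasAntidiagonal.antidiagonal n, a p.1 * b p.2 with hc
  have hprod : HasFPowerSeriesAt (fun _ : ℂ => (1 : ℂ))
      (FormalMultilinearSeries.ofScalars ℂ c) 0 := by
    rw [hasFPowerSeriesAt_iff]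
    filter_upwards [hball, hne] with z hz hz₀
    have hsa := (ha z hz).summable.norm
    have hsb := (hb z hz).summable.norm
    have hs := (summable_norm_sum_mul_antidiagonal_of_summable_norm hsa hsb).of_norm.hasSum
    rw [← tsum_mul_tsum_eq_tsum_sum_antidiagonal_of_summable_norm hsa hsb,
      (ha z hz).tsum_eq, (hb z hz).tsum_eq, mul_inv_cancel₀ hz₀] at hs
    convert hs using 2 with k
    rw [FormalMultilinearSeries.coeff_ofScalars, smul_eq_mul, hc, Finset.mul_sum]
    refine Finset.sum_congr rfl fun p hp => ?_
    rw [← Finset.HasAntidiagonal.mem_antidiagonal.1 hp]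
    ring
  have hone : HasFPowerSeriesAt (fun _ : ℂ => (1 : ℂ))
      (FormalMultilinearSeries.ofScalars ℂ fun n => if n = 0 then (1 : ℂ) else 0) 0 := by
    rw [hasFPowerSeriesAt_iff]
    refine Eventually.of_forall fun z => ?_
    have h := hasSum_single (f := fun k => z ^ k • (FormalMultilinearSeries.ofScalars ℂ
      fun n => if n = 0 then (1 : ℂ) else 0).coeff k) 0
      fun k hk => by simp [FormalMultilinearSeries.coeff_ofScalars, hk]
    simpa only [FormalMultilinearSeries.coeff_ofScalars, pow_zero, if_true, one_smul] using h
  have h := congrArg (fun p => p.coeff n) (hprod.eq_formalMultilinearSeries hone)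
  simpa only [FormalMultilinearSeries.coeff_ofScalars] using h

theorem norm_betaT_iterate_one_le (β : ℝ) (n : ℕ) : ‖(betaT β)^[n] (1 : ℝ)‖ ≤ 1 := by
  cases n with
  | zero => simp
  | succ n =>
    rw [Function.iterate_succ_apply', betaT, Real.norm_eq_abs, abs_of_nonneg (Int.fract_nonneg _)]
    exact (Int.fract_lt_one _).le

theorem norm_betaT_iterate_div_pow_le {β : ℝ} (hβ : 1 < β) (n : ℕ) :
    ‖(betaT β)^[n] 1 / β ^ n‖ ≤ β⁻¹ ^ n := by
  have hpos : 0 < β := one_pos.trans hβ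
  rw [norm_div, norm_pow, Real.norm_of_nonneg hpos.le, inv_pow, ← one_div]
  gcongr
  exact norm_betaT_iterate_one_le β n

theorem summable_norm_betaT_iterate_div_pow {β : ℝ} (hβ : 1 < β) :
    Summable fun n => ‖(betaT β)^[n] 1 / β ^ n‖ :=
  .of_nonneg_of_le (fun _ => norm_nonneg _) (norm_betaT_iterate_div_pow_le hβ)
    (summable_geometric_of_lt_one (inv_nonneg.2 (one_pos.trans hβ).le) (inv_lt_one_of_one_lt₀ hβ))

theorem hasSum_xiFun {β : ℝ} (hβ : 1 < β) {z : ℂ} (hz : ‖z‖ < 1) :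
    HasSum (fun n => (((betaT β)^[n] 1 / β ^ n : ℝ) : ℂ) * z ^ n) (xiFun β z) := by
  have hs : Summable fun n => (((betaT β)^[n] 1 / β ^ n : ℝ) : ℂ) * z ^ n := by
    refine .of_norm_bounded (summable_norm_betaT_iterate_div_pow hβ) fun n => ?_
    rw [norm_mul, norm_pow, Complex.norm_real]
    exact mul_le_of_le_one_right (norm_nonneg _) (pow_le_one₀ (norm_nonneg _) hz.le)
  convert hs.hasSum using 1
  refine tsum_congr fun n => ?_
  push_cast
  ring

/-- Let `β₀ > 1` be non-simple, `θ` an invertible bi-measurable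
measure-preserving map of a probability space, and `(t n)` the Maclaurin coefficients of
`1/ξ` (characterized by `∑ t_n zⁿ = (ξ z)⁻¹` on a ball of radius `r > 1`). Then
`∑ |t_n| < ∞`, and for every `f ∈ L¹(P)` the series `g = ∑ t_n (f ∘ θ^{-n})` converges in
`L¹(P)` and satisfies `g + Vg = f` a.e.; moreover `∑ t_n ((f + Vf) ∘ θ^{-n}) = f` a.e., i.e.
`I + V` is invertible on `L¹(P)` with inverse `∑ t_n U_{θ^{-1}}ⁿ`. -/
theorem stmt_18 {Ω : Type*} [MeasurableSpace Ω] (P : Measure Ω) [IsProbabilityMeasure P]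
    (θ θinv : Ω → Ω) (hθ : MeasurePreserving θ P P) (hθinv : MeasurePreserving θinv P P)
    (hli : Function.LeftInverse θinv θ) (hri : Function.RightInverse θinv θ)
    (β₀ : ℝ) (hβ₀ : 1 < β₀)
    (hns : ∀ N : ℕ, 1 ≤ N → (betaT β₀)^[N] 1 ≠ 0)
    (t : ℕ → ℝ) (r : ℝ) (hr : 1 < r)
    (ht : ∀ z : ℂ, ‖z‖ < r → HasSum (fun n : ℕ => ((t n : ℝ) : ℂ) * z ^ n) (xiFun β₀ z)⁻¹) :
    (Summable fun n : ℕ => |t n|) ∧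
    ∀ f : Ω → ℝ, Integrable f P →
      Integrable (fun ω => ∑' n : ℕ, t n * f (θinv^[n] ω)) P ∧
      Tendsto (fun N : ℕ => ∫ ω,
          |(∑ n ∈ Finset.range N, t n * f (θinv^[n] ω))
            - ∑' n : ℕ, t n * f (θinv^[n] ω)| ∂P) atTop (nhds 0) ∧
      (∀ᵐ ω ∂P,
        (∑' n : ℕ, t n * f (θinv^[n] ω))
          + VOp β₀ θinv (fun ν => ∑' n : ℕ, t n * f (θinv^[n] ν)) ω = f ω) ∧
      (∀ᵐ ω ∂P,
        (∑' n : ℕ, t n * (f (θinv^[n] ω) + VOp β₀ θinv f (θinv^[n] ω))) = f ω) := by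
  have htsum : Summable fun n => ‖t n‖ := by
    have h := (ht 1 (by simpa using hr)).summable.norm
    simpa using h
  refine ⟨htsum, fun f hf => ?_⟩
  set a : ℕ → ℝ := fun n => (betaT β₀)^[n] 1 / β₀ ^ n with ha
  have hasum : Summable fun n => ‖a n‖ := summable_norm_betaT_iterate_div_pow hβ₀
  have ha₀ : a 0 = 1 := by simp [ha]
  have hat (n : ℕ) : ∑ p ∈ Finset.HasAntidiagonal.antidiagonal n, a p.1 * t p.2 =
      if n = 0 then 1 else 0 := by
    have h := sum_antidiagonal_eq_of_hasSum_inv (a := fun n => (a n : ℂ)) (b := fun n => (t n : ℂ))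
      (by simp [ha₀]) (fun z hz => hasSum_xiFun hβ₀ hz) (fun z hz => ht z (hz.trans hr)) n
    apply Complex.ofReal_injective
    push_cast
    rw [h, apply_ite Complex.ofReal, Complex.ofReal_one, Complex.ofReal_zero]
  have hta (n : ℕ) : ∑ p ∈ Finset.HasAntidiagonal.antidiagonal n, t p.1 * a p.2 =
      if n = 0 then 1 else 0 := by
    rw [← hat n, ← Finset.Nat.sum_antidiagonal_swap]
    simp [mul_comm]
  have hF : ∑' n, eLpNorm (fun ω => t n * f (θinv^[n] ω)) 1 P ≠ ⊤ :=
    tsum_eLpNorm_mul_comp_iterate_ne_top hθinv hf htsum id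
  obtain ⟨hint, htendsto⟩ := integrable_tsum_and_tendsto_of_tsum_eLpNorm_ne_top
    (fun n => aestronglyMeasurable_mul_comp_iterate hθinv hf (t n) n) hF
  have hdouble {b c : ℕ → ℝ} (hb : Summable fun n => ‖b n‖) (hc : Summable fun n => ‖c n‖) :
      ∀ᵐ ω ∂P, Summable fun p : ℕ × ℕ => b p.1 * c p.2 * f (θinv^[p.1 + p.2] ω) := by
    have h := summable_norm_of_tsum_eLpNorm_ne_top le_rfl
      (fun p : ℕ × ℕ => aestronglyMeasurable_mul_comp_iterate hθinv hf (b p.1 * c p.2) (p.1 + p.2))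
      (tsum_eLpNorm_mul_comp_iterate_ne_top hθinv hf (hb.mul_norm hc) fun p => p.1 + p.2)
    filter_upwards [h] with ω hω using hω.of_norm
  have hiter (m k : ℕ) (ω : Ω) : θinv^[k] (θinv^[m] ω) = θinv^[m + k] ω := by
    rw [add_comm, Function.iterate_add_apply]
  refine ⟨hint, htendsto, ?_, ?_⟩
  · filter_upwards [hdouble hasum htsum] with ω hω
    have hmain := tsum_mul_tsum_shift_eq_of_antidiagonal
      (x := fun n => f (θinv^[n] ω)) hat hω
    have hs : Summable fun m => a m * ∑' k, t k * f (θinv^[m + k] ω) := by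
      simpa only [mul_assoc, tsum_mul_left] using hω.prod
    rw [hs.tsum_eq_zero_add] at hmain
    simpa only [VOp, hiter, ha₀, one_mul, zero_add, Function.iterate_zero, id] using hmain
  · filter_upwards [hdouble htsum hasum] with ω hω
    have hmain := tsum_mul_tsum_shift_eq_of_antidiagonal
      (x := fun n => f (θinv^[n] ω)) hta hω
    refine Eq.trans (tsum_congr fun n => ?_) hmain
    rcases eq_or_ne (t n) 0 with h0 | h0
    · simp [h0]
    have hs : Summable fun m => a m * f (θinv^[n + m] ω) := by
      have h := hω.prod_factor n
      simp only [mul_assoc] at h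
      exact (summable_mul_left_iff h0).1 h
    rw [hs.tsum_eq_zero_add]
    simp only [VOp, hiter, ha₀, one_mul, add_zero, a]
end

section
/- Let β₀ > 1 be non-simple and let N ≥ 1 be a positive integer. Then there exists δ > 0 such that for every β with |β − β₀| < δ one has β > 1, ⌊β⌋ = ⌊β₀⌋, and ⌊β · T_β^i(1)⌋ = ⌊β₀ · T_{β₀}^i(1)⌋ for every 1 ≤ i ≤ N. -/
open Filter Topology in
/-- The floor of a continuous function is locally constant where the value is not an integer. -/
theorem ContinuousAt.eventually_floor_eq {X : Type*} [TopologicalSpace X] {f : X → ℝ} {a : X}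
    (hf : ContinuousAt f a) (ha : Int.fract (f a) ≠ 0) : ∀ᶠ x in 𝓝 a, ⌊f x⌋ = ⌊f a⌋ := by
  have hlt : (⌊f a⌋ : ℝ) < f a := by
    have h := (Int.fract_nonneg (f a)).lt_of_ne' ha
    rw [Int.fract] at h
    linarith
  filter_upwards [hf.eventually (Ioo_mem_nhds hlt (Int.lt_floor_add_one (f a)))] with x hx
  exact Int.floor_eq_iff.2 ⟨hx.1.le, hx.2⟩

open Filter Topology in
/-- The fractional part of a continuous function is continuous where the value is not an
integer. -/
theorem ContinuousAt.fract_of_ne_zero {X : Type*} [TopologicalSpace X] {f : X → ℝ} {a : X}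
    (hf : ContinuousAt f a) (ha : Int.fract (f a) ≠ 0) :
    ContinuousAt (fun x => Int.fract (f x)) a := by
  have h : (fun x => f x - (⌊f a⌋ : ℝ)) =ᶠ[𝓝 a] fun x => Int.fract (f x) := by
    filter_upwards [hf.eventually_floor_eq ha] with x hx
    rw [Int.fract, hx]
  exact (hf.sub continuousAt_const).congr h

/-- The orbit of `1` depends continuously on the base at a non-simple number. -/
theorem continuousAt_iterate_betaT {β₀ : ℝ}
    (hns : ∀ n : ℕ, 1 ≤ n → (betaT β₀)^[n] 1 ≠ 0) (n : ℕ) :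
    ContinuousAt (fun β => (betaT β)^[n] 1) β₀ := by
  induction n with
  | zero => exact continuousAt_const
  | succ n ih =>
    have h := hns (n + 1) n.succ_pos
    simp only [Function.iterate_succ_apply'] at h ⊢
    exact (continuousAt_id.mul ih).fract_of_ne_zero h

open Filter Topology in
/-- At a non-simple number each digit of the expansion of `1` is locally constant in the base. -/
theorem eventually_floor_mul_iterate_betaT_eq {β₀ : ℝ}
    (hns : ∀ n : ℕ, 1 ≤ n → (betaT β₀)^[n] 1 ≠ 0) (n : ℕ) :
    ∀ᶠ β in 𝓝 β₀, ⌊β * (betaT β)^[n] 1⌋ = ⌊β₀ * (betaT β₀)^[n] 1⌋ := by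
  have h := hns (n + 1) n.succ_pos
  rw [Function.iterate_succ_apply'] at h
  exact (continuousAt_id.mul (continuousAt_iterate_betaT hns n)).eventually_floor_eq h

/-- Let `β₀ > 1` be non-simple (`T_{β₀}^N(1) ≠ 0` for all `N ≥ 1`) and
`N ≥ 1`. Then there is `δ > 0` such that every `β` with `|β - β₀| < δ` satisfies `β > 1`,
`⌊β⌋ = ⌊β₀⌋`, and `⌊β T_β^i(1)⌋ = ⌊β₀ T_{β₀}^i(1)⌋` for all `1 ≤ i ≤ N`. -/
theorem stmt_19 (β₀ : ℝ) (hβ₀ : 1 < β₀)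
    (hns : ∀ n : ℕ, 1 ≤ n → (betaT β₀)^[n] 1 ≠ 0)
    (N : ℕ) (hN : 1 ≤ N) :
    ∃ δ : ℝ, 0 < δ ∧ ∀ β : ℝ, |β - β₀| < δ →
      1 < β ∧ ⌊β⌋ = ⌊β₀⌋ ∧
      ∀ i : ℕ, 1 ≤ i → i ≤ N →
        ⌊β * (betaT β)^[i] 1⌋ = ⌊β₀ * (betaT β₀)^[i] 1⌋ := by
  have hall := (Filter.eventually_all_finset (Finset.range (N + 1))).2
    fun i _ => eventually_floor_mul_iterate_betaT_eq hns i
  obtain ⟨δ, hδ, h⟩ := Metric.eventually_nhds_iff.1 ((lt_mem_nhds hβ₀).and hall)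
  refine ⟨δ, hδ, fun β hβ => ?_⟩
  obtain ⟨h1, h2⟩ := h (by rwa [Real.dist_eq] : dist β β₀ < δ)
  refine ⟨h1, ?_, fun i _ hi => h2 i (Finset.mem_range.2 (Nat.lt_succ_of_le hi))⟩
  simpa using h2 0 (Finset.mem_range.2 N.succ_pos)
end
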